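/- arXiv:2102.07622 — 2 statements merged into one kernel-verified Lean document; each statement's English description precedes it below -/
import Mathlib

section
/- Fix an integer d ≥ 1 and let m = n + d. There exist a constant c > 0 and N ∈ ℕ such that for all n ≥ N: every finite set Q of queries over the variables P_{i,j} (i ∈ [m], j ∈ [n]) whose slabs cover every point of {0,1/2,1}^{[m]×[n]} satisfying all inequalities of PHP^m_n satisfies |Q| ≥ c·n^{1/4}. -/
theorem aux_middle (t : ℕ) : (t.choose (t / 2)) ^ 2 * (t + 1) ≤ 4 ^ t := by
  have hc : ∀ k : ℕ, (Nat.centralBinom k) ^ 2 * (2 * k + 1) ≤ 16 ^ k := by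
    intro k
    induction k with
    | zero => simp
    | succ k ih =>
      have h := Nat.succ_mul_centralBinom_succ k
      have hpos : 0 < (k + 1) ^ 2 := by positivity
      refine Nat.le_of_mul_le_mul_left ?_ hpos
      calc (k + 1) ^ 2 * ((Nat.centralBinom (k + 1)) ^ 2 * (2 * (k + 1) + 1))
          = ((k + 1) * Nat.centralBinom (k + 1)) ^ 2 * (2 * k + 3) := by ring
        _ = (2 * (2 * k + 1) * Nat.centralBinom k) ^ 2 * (2 * k + 3) := by rw [h]
        _ = (Nat.centralBinom k ^ 2 * (2 * k + 1)) * (4 * ((2 * k + 1) * (2 * k + 3))) := by ring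
        _ ≤ 16 ^ k * (4 * ((2 * k + 1) * (2 * k + 3))) := Nat.mul_le_mul_right _ ih
        _ ≤ 16 ^ k * (16 * (k + 1) ^ 2) := by
            apply Nat.mul_le_mul_left; nlinarith
        _ = (k + 1) ^ 2 * 16 ^ (k + 1) := by ring
  rcases Nat.even_or_odd' t with ⟨k, rfl | rfl⟩
  · have h := hc k
    rw [Nat.centralBinom_eq_two_mul_choose] at h
    have e : 2 * k / 2 = k := by omega
    rw [e, pow_mul]
    simpa using h
  · have h := hc (k + 1)
    have e : (2 * k + 1) / 2 = k := by omega
    have h2 : Nat.centralBinom (k + 1) = 2 * (2 * k + 1).choose k := by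
      rw [Nat.centralBinom_eq_two_mul_choose]
      have h1 : 2 * (k + 1) = (2 * k + 1) + 1 := by ring
      rw [h1, Nat.choose_succ_succ]
      have h3 : (2 * k + 1).choose (k + 1) = (2 * k + 1).choose k :=
        Nat.choose_symm_half k
      simp only [Nat.succ_eq_add_one]
      omega
    rw [h2] at h
    have h4 : 4 ^ (2 * k + 1) = 4 * 16 ^ k := by rw [pow_succ, pow_mul]; norm_num; ring
    rw [e, h4]
    rw [pow_succ 16 k] at h
    nlinarith

theorem aux_LO {α : Type*} [Fintype α] [DecidableEq α] (a : α → ℤ) (ha : ∀ v, a v ≠ 0) (c : ℤ) :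
    (Finset.univ.filter (fun S : Finset α => ∑ v ∈ S, a v = c)).card ≤
      (Fintype.card α).choose (Fintype.card α / 2) := by
  classical
  set N : Finset α := Finset.univ.filter (fun v => a v < 0) with hN
  have key : ∀ S : Finset α, ∑ v ∈ symmDiff S N, |a v| = ∑ v ∈ S, a v - ∑ v ∈ N, a v := by
    intro S
    have e : ∀ (S : Finset α) (f : α → ℤ), ∑ v ∈ S, f v = ∑ v, if v ∈ S then f v else 0 := by
      intro S f
      simp
    rw [e, e S, e N, ← Finset.sum_sub_distrib]
    apply Finset.sum_congr rfl
    intro v _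
    rcases lt_or_gt_of_ne (ha v) with h | h
    · by_cases hS : v ∈ S <;> simp [Finset.mem_symmDiff, hN, hS, h, abs_of_neg]
    · have h' : ¬ a v < 0 := by omega
      by_cases hS : v ∈ S <;> simp [Finset.mem_symmDiff, hN, hS, h', abs_of_pos h]
  set A := Finset.univ.filter (fun S : Finset α => ∑ v ∈ S, a v = c) with hA
  have hinj : Function.Injective (fun S : Finset α => symmDiff S N) := symmDiff_left_injective N
  have hanti : IsAntichain (· ⊆ ·) (SetLike.coe (A.image (fun S => symmDiff S N))) := by
    intro X hX Y hY hne hsub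
    simp only [Finset.coe_image, Set.mem_image, Finset.mem_coe] at hX hY
    obtain ⟨S, hS, rfl⟩ := hX
    obtain ⟨S', hS', rfl⟩ := hY
    have h1 : ∑ v ∈ symmDiff S N, |a v| = ∑ v ∈ symmDiff S' N, |a v| := by
      rw [key, key, (Finset.mem_filter.1 hS).2, (Finset.mem_filter.1 hS').2]
    have hss : symmDiff S N ⊂ symmDiff S' N := Finset.ssubset_iff_subset_ne.2 ⟨hsub, hne⟩
    obtain ⟨v, hv, hv'⟩ := Finset.exists_of_ssubset hss
    have : ∑ v ∈ symmDiff S N, |a v| < ∑ v ∈ symmDiff S' N, |a v| :=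
      Finset.sum_lt_sum_of_subset hsub hv hv' (abs_pos.2 (ha v)) (fun j _ _ => abs_nonneg _)
    omega
  have := hanti.sperner
  rwa [Finset.card_image_of_injective _ hinj] at this

theorem aux_LO' {V : Type*} [DecidableEq V] (F T : Finset V) (hTF : T ⊆ F) (a : V → ℤ)
    (hT : ∀ v ∈ T, a v ≠ 0) (hF : ∀ v ∈ F, v ∉ T → a v = 0) (c : ℤ) :
    (F.powerset.filter (fun S => ∑ v ∈ S, a v = c)).card ^ 2 * (T.card + 1) ≤ 4 ^ F.card := by
  classical
  have h1 := aux_LO (fun v : T => a v) (fun v => hT v v.2) c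
  rw [Fintype.card_coe] at h1
  have h2 : (F.powerset.filter (fun S => ∑ v ∈ S, a v = c)).card ≤
      (Finset.univ.filter (fun S : Finset T => ∑ v ∈ S, a v = c)).card * 2 ^ (F \ T).card := by
    rw [← Finset.card_powerset, ← Finset.card_product]
    apply Finset.card_le_card_of_injOn (fun S => (S.subtype (· ∈ T), S \ T))
    · intro S hS
      simp only [Finset.coe_filter, Finset.mem_powerset, Set.mem_setOf_eq] at hS
      simp only [Finset.coe_product, Set.mem_prod, Finset.mem_coe, Finset.mem_filter,
        Finset.mem_univ, true_and, Finset.mem_powerset]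
      refine ⟨?_, Finset.sdiff_subset_sdiff hS.1 le_rfl⟩
      rw [← hS.2, Finset.sum_subtype_eq_sum_filter, Finset.sum_filter]
      apply Finset.sum_congr rfl
      intro v hv
      split_ifs with h
      · rfl
      · exact (hF v (hS.1 hv) h).symm
    · intro S _ S' _ h
      simp only [Prod.mk.injEq] at h
      ext v
      by_cases hv : v ∈ T
      · have := Finset.ext_iff.1 h.1 ⟨v, hv⟩
        simpa using this
      · have := Finset.ext_iff.1 h.2 v
        simpa [hv] using this
  have h3 := aux_middle T.card
  have h4 : F.card = T.card + (F \ T).card := by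
    have := Finset.card_sdiff_add_card_eq_card hTF
    omega
  have h5 := h2.trans (Nat.mul_le_mul_right _ h1)
  calc _ ≤ ((T.card).choose (T.card / 2) * 2 ^ (F \ T).card) ^ 2 * (T.card + 1) :=
        Nat.mul_le_mul_right _ (Nat.pow_le_pow_left h5 2)
    _ = ((T.card).choose (T.card / 2)) ^ 2 * (T.card + 1) * 4 ^ (F \ T).card := by
        rw [mul_pow, ← pow_mul, mul_comm _ 2, pow_mul]; norm_num; ring
    _ ≤ 4 ^ T.card * 4 ^ (F \ T).card := Nat.mul_le_mul_right _ h3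
    _ = 4 ^ F.card := by rw [h4, pow_add]

theorem aux_kill {V ι : Type*} [DecidableEq V] [DecidableEq ι] (Q : Finset ι)
    (s : ι → Finset V) (W : ℕ) :
    ∃ K : Finset V, K.card ≤ Q.card * W ∧ ∀ q ∈ Q, s q ⊆ K ∨ W < (s q \ K).card := by
  classical
  obtain ⟨D, hD, hmax⟩ := Finset.exists_max_image
    (Q.powerset.filter (fun D => (D.biUnion s).card ≤ D.card * W)) Finset.card
    ⟨∅, by simp⟩
  simp only [Finset.mem_filter, Finset.mem_powerset] at hD hmax
  refine ⟨D.biUnion s, hD.2.trans (Nat.mul_le_mul_right _ (Finset.card_le_card hD.1)), ?_⟩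
  intro q hq
  by_cases hqD : q ∈ D
  · exact Or.inl (Finset.subset_biUnion_of_mem s hqD)
  · right
    by_contra hlt
    push Not at hlt
    have h := hmax (insert q D) ⟨Finset.insert_subset hq hD.1, by
      rw [Finset.biUnion_insert, Finset.card_insert_of_notMem hqD, ← Finset.sdiff_union_self_eq_union]
      refine (Finset.card_union_le _ _).trans ?_
      have := hD.2
      nlinarith⟩
    rw [Finset.card_insert_of_notMem hqD] at h
    omega

/-- Number of subsets of `F` meeting `A` in at most one point. -/
theorem aux_bad {V : Type*} [DecidableEq V] (F A : Finset V) (hA : A ⊆ F) (q : ℕ)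
    (hq : 2 * q ≤ A.card) :
    (F.powerset.filter (fun S => (S ∩ A).card ≤ 1)).card * 2 ^ q ≤ 2 * 2 ^ F.card := by
  classical
  obtain ⟨A1, h1, c1⟩ := Finset.exists_subset_card_eq (show q ≤ A.card by omega)
  obtain ⟨A2, h2, c2⟩ := Finset.exists_subset_card_eq (s := A \ A1) (n := q) (by
    rw [Finset.card_sdiff_of_subset h1]; omega)
  have hsub : F.powerset.filter (fun S => (S ∩ A).card ≤ 1) ⊆
      (F \ A1).powerset ∪ (F \ A2).powerset := by
    intro S hS
    simp only [Finset.mem_filter, Finset.mem_powerset] at hS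
    simp only [Finset.mem_union, Finset.mem_powerset]
    by_contra hcon
    push Not at hcon
    obtain ⟨⟨x, hx, hx'⟩, ⟨y, hy, hy'⟩⟩ := And.imp Finset.not_subset.1 Finset.not_subset.1 hcon
    have hx1 : x ∈ A1 := by
      by_contra h; exact hx' (Finset.mem_sdiff.2 ⟨hS.1 hx, h⟩)
    have hy1 : y ∈ A2 := by
      by_contra h; exact hy' (Finset.mem_sdiff.2 ⟨hS.1 hy, h⟩)
    have hyA := Finset.mem_sdiff.1 (h2 hy1)
    have := Finset.card_le_one.1 hS.2 x (Finset.mem_inter.2 ⟨hx, h1 hx1⟩) y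
      (Finset.mem_inter.2 ⟨hy, hyA.1⟩)
    subst this
    exact hyA.2 hx1
  have h3 := (Finset.card_le_card hsub).trans (Finset.card_union_le _ _)
  have hA2 : A2 ⊆ F := fun x hx => hA (Finset.mem_sdiff.1 (h2 hx)).1
  rw [Finset.card_powerset, Finset.card_powerset, Finset.card_sdiff_of_subset (h1.trans hA),
    Finset.card_sdiff_of_subset hA2, c1, c2] at h3
  have h4 : q ≤ F.card := by have := Finset.card_le_card hA; omega
  calc _ ≤ (2 ^ (F.card - q) + 2 ^ (F.card - q)) * 2 ^ q := Nat.mul_le_mul_right _ h3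
    _ = 2 * (2 ^ (F.card - q) * 2 ^ q) := by ring
    _ = 2 * 2 ^ F.card := by rw [← pow_add, Nat.sub_add_cancel h4]

theorem aux_main (n m : ℕ) (hn : 8 * m ≤ 2 ^ (n / 4))
    (Q : Finset ((Fin m × Fin n → ℤ) × ℤ))
    (hQ : 32 * Q.card ^ 3 ≤ n)
    (hcov : ∀ x : Fin m × Fin n → ℝ,
      (∀ p, x p = 0 ∨ x p = 1/2 ∨ x p = 1) →
      (∀ i, 1 ≤ ∑ j, x (i, j)) →
      (∀ k i j, i ≠ j → x (i, k) + x (j, k) ≤ 1) →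
      ∃ a ∈ Q, (a.2 : ℝ) - 1 < ∑ p, (a.1 p : ℝ) * x p ∧
        ∑ p, (a.1 p : ℝ) * x p < (a.2 : ℝ)) : False := by
  classical
  set s := Q.card with hs
  obtain ⟨K, hK, hkill⟩ := aux_kill Q
    (fun a => Finset.univ.filter (fun p => a.1 p ≠ 0)) (16 * s ^ 2)
  set F : Finset (Fin m × Fin n) := Finset.univ \ K with hF
  let row : Fin m → Finset (Fin m × Fin n) := fun i =>
    (Finset.univ.map ⟨fun j : Fin n => (i, j), fun j j' h => by simpa using h⟩)
  have hrow : ∀ i, 2 * (n / 4) ≤ (row i \ K).card := by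
    intro i
    have h1 : (row i).card = n := by simp [row]
    have h2 := Finset.le_card_sdiff K (row i)
    have h3 : s * (16 * s ^ 2) = 16 * s ^ 3 := by ring
    rw [← hs, h3] at hK
    omega
  set W := Q.filter (fun a => 16 * s ^ 2 < ((Finset.univ.filter (fun p => a.1 p ≠ 0)) \ K).card)
    with hW
  let fam : ((Fin m × Fin n → ℤ) × ℤ) → Finset (Finset (Fin m × Fin n)) := fun a =>
    F.powerset.filter (fun S => ∑ v ∈ S, a.1 v = 2 * a.2 - 1)
  let bad : Fin m → Finset (Finset (Fin m × Fin n)) := fun i =>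
    F.powerset.filter (fun S => (S ∩ (row i \ K)).card ≤ 1)
  have hsub : F.powerset ⊆ W.biUnion fam ∪ Finset.univ.biUnion bad := by
    intro S hS
    by_contra hcon
    simp only [Finset.mem_union, Finset.mem_biUnion, not_or, not_exists, not_and, Finset.mem_univ,
      true_and] at hcon
    obtain ⟨hnf, hnb⟩ := hcon
    have hSK : ∀ p ∈ S, p ∉ K := fun p hp =>
      (Finset.mem_sdiff.1 (Finset.mem_powerset.1 hS hp)).2
    obtain ⟨a, haQ, hlo, hhi⟩ := hcov (fun p => if p ∈ S then 1/2 else 0)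
      (by intro p; by_cases h : p ∈ S <;> simp [h])
      (by
        intro i
        have h2 : 2 ≤ (S ∩ (row i \ K)).card := by
          by_contra h
          exact hnb i (Finset.mem_filter.2 ⟨hS, by omega⟩)
        have h3 : (S ∩ (row i \ K)).card ≤ (Finset.univ.filter (fun j => (i, j) ∈ S)).card := by
          rw [← Finset.card_map (⟨fun j : Fin n => (i, j), fun j j' h => by simpa using h⟩ :
            Fin n ↪ Fin m × Fin n)]
          apply Finset.card_le_card
          intro p hp
          simp only [Finset.mem_inter, Finset.mem_sdiff, row, Finset.mem_map, Finset.mem_univ,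
            true_and, Function.Embedding.coeFn_mk] at hp
          obtain ⟨hpS, ⟨j, rfl⟩, _⟩ := hp
          simp only [Finset.mem_map, Finset.mem_filter, Finset.mem_univ, true_and]
          exact ⟨j, hpS, rfl⟩
        rw [← Finset.sum_filter, Finset.sum_const, nsmul_eq_mul]
        have : (2 : ℝ) ≤ ((Finset.univ.filter (fun j => (i, j) ∈ S)).card : ℝ) := by
          exact_mod_cast h2.trans h3
        linarith)
      (by
        intro k i j _
        split_ifs <;> norm_num)
    have hsum : ∑ p, (a.1 p : ℝ) * (if p ∈ S then 1/2 else 0 : ℝ) =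
        ((∑ v ∈ S, a.1 v : ℤ) : ℝ) / 2 := by
      push_cast
      rw [Finset.sum_div]
      simp [div_eq_mul_inv]
    rw [hsum] at hlo hhi
    have hlo' : 2 * a.2 - 2 < ∑ v ∈ S, a.1 v := by
      have : ((2 * a.2 - 2 : ℤ) : ℝ) < ((∑ v ∈ S, a.1 v : ℤ) : ℝ) := by
        push_cast at *; linarith
      exact_mod_cast this
    have hhi' : ∑ v ∈ S, a.1 v < 2 * a.2 := by
      have : ((∑ v ∈ S, a.1 v : ℤ) : ℝ) < ((2 * a.2 : ℤ) : ℝ) := by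
        push_cast at *; linarith
      exact_mod_cast this
    rcases hkill a haQ with h | h
    · have h0 : ∑ v ∈ S, a.1 v = 0 := by
        apply Finset.sum_eq_zero
        intro v hv
        by_contra hne
        exact hSK v hv (h (by simpa using hne))
      omega
    · exact hnf a (Finset.mem_filter.2 ⟨haQ, h⟩) (Finset.mem_filter.2 ⟨hS, by omega⟩)
  have hfam : ∀ a ∈ W, (fam a).card * (4 * s) ≤ 2 ^ F.card := by
    intro a ha
    have h1 := aux_LO' F ((Finset.univ.filter (fun p => a.1 p ≠ 0)) \ K)
      (Finset.sdiff_subset_sdiff (Finset.subset_univ _) le_rfl) a.1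
      (by intro v hv; simp at hv; exact hv.1)
      (by
        intro v hv hv'
        by_contra hne
        exact hv' (by simpa [hne] using (Finset.mem_sdiff.1 hv).2)) (2 * a.2 - 1)
    have h2 := (Finset.mem_filter.1 ha).2
    have h3 : ((fam a).card * (4 * s)) ^ 2 ≤ (2 ^ F.card) ^ 2 := by
      calc ((fam a).card * (4 * s)) ^ 2 = (fam a).card ^ 2 * (16 * s ^ 2) := by ring
        _ ≤ (fam a).card ^ 2 *
          (((Finset.univ.filter (fun p => a.1 p ≠ 0)) \ K).card + 1) := by
            apply Nat.mul_le_mul_left; omega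
        _ ≤ 4 ^ F.card := h1
        _ = (2 ^ F.card) ^ 2 := by rw [← pow_mul, mul_comm, pow_mul]; norm_num
    exact (Nat.pow_le_pow_iff_left (by norm_num)).1 h3
  have hbad : ∀ i, (bad i).card * 2 ^ (n / 4) ≤ 2 * 2 ^ F.card := fun i =>
    aux_bad F (row i \ K) (Finset.sdiff_subset_sdiff (Finset.subset_univ _) le_rfl) _ (hrow i)
  have htot : 2 ^ F.card ≤ ∑ a ∈ W, (fam a).card + ∑ i, (bad i).card := by
    have h := (Finset.card_le_card hsub).trans (Finset.card_union_le _ _)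
    rw [Finset.card_powerset] at h
    exact h.trans (Nat.add_le_add Finset.card_biUnion_le Finset.card_biUnion_le)
  have hP : 0 < 2 ^ F.card := by positivity
  have hX : 4 * ∑ a ∈ W, (fam a).card ≤ 2 ^ F.card := by
    have hWs : W.card ≤ s := Finset.card_le_card (Finset.filter_subset _ _)
    rcases Nat.eq_zero_or_pos s with h0 | h0
    · have : W = ∅ := Finset.card_eq_zero.1 (by omega)
      simp [this]
    · have h1 : (∑ a ∈ W, (fam a).card) * (4 * s) ≤ W.card * 2 ^ F.card := by
        rw [Finset.sum_mul]
        exact (Finset.sum_le_card_nsmul _ _ _ hfam).trans (by simp)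
      have h2 : W.card * 2 ^ F.card ≤ s * 2 ^ F.card := Nat.mul_le_mul_right _ hWs
      refine Nat.le_of_mul_le_mul_left ?_ h0
      calc _ = (∑ a ∈ W, (fam a).card) * (4 * s) := by ring
        _ ≤ _ := h1.trans h2
  have hY : 4 * ∑ i, (bad i).card ≤ 2 ^ F.card := by
    have h1 : (∑ i, (bad i).card) * 2 ^ (n / 4) ≤ m * (2 * 2 ^ F.card) := by
      have : ∑ i : Fin m, 2 * 2 ^ F.card = m * (2 * 2 ^ F.card) := by simp
      rw [Finset.sum_mul, ← this]
      exact Finset.sum_le_sum fun i _ => hbad i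
    refine Nat.le_of_mul_le_mul_left ?_ (show 0 < 2 ^ (n / 4) by positivity)
    calc _ = 4 * ((∑ i, (bad i).card) * 2 ^ (n / 4)) := by ring
      _ ≤ 4 * (m * (2 * 2 ^ F.card)) := Nat.mul_le_mul_left _ h1
      _ = (8 * m) * 2 ^ F.card := by ring
      _ ≤ _ := Nat.mul_le_mul_right _ hn
  omega

/-- fix `d ≥ 1` and let `m = n + d`.  There are `c > 0` and `N` such
that for all `n ≥ N`: every finite set `Q` of queries over the variables
`P_{i,j}` (`i ∈ [m]`, `j ∈ [n]`) whose slabs cover every point of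
`{0,1/2,1}^{[m]×[n]}` satisfying all inequalities of `PHP^m_n` has
`|Q| ≥ c · n^{1/4}`. -/
theorem statement_6 (d : ℕ) (hd : 1 ≤ d) : ∃ c : ℝ, 0 < c ∧ ∃ N : ℕ, ∀ n ≥ N,
    ∀ Q : Finset ((Fin (n + d) × Fin n → ℤ) × ℤ),
    (∀ x : Fin (n + d) × Fin n → ℝ,
      (∀ p, x p = 0 ∨ x p = 1/2 ∨ x p = 1) →
      (∀ i, 1 ≤ ∑ j, x (i, j)) →
      (∀ k i j, i ≠ j → x (i, k) + x (j, k) ≤ 1) →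
      ∃ a ∈ Q, (a.2 : ℝ) - 1 < ∑ p, (a.1 p : ℝ) * x p ∧
        ∑ p, (a.1 p : ℝ) * x p < (a.2 : ℝ)) →
    c * (n : ℝ) ^ ((1 : ℝ) / 4) ≤ (Q.card : ℝ) := by
  refine ⟨1 / 4, by norm_num, 4 * (d + 10), ?_⟩
  intro n hn Q hcov
  by_contra hlt
  push Not at hlt
  refine aux_main n (n + d) ?_ Q ?_ hcov
  · have hp : ∀ r : ℕ, 40 * (r + 10) + 24 ≤ 2 ^ (r + 10) := by
      intro r
      induction r with
      | zero => norm_num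
      | succ r ih =>
        have : 2 ^ (r + 1 + 10) = 2 * 2 ^ (r + 10) := by ring
        omega
    have h1 := hp (n / 4 - 10)
    have h2 : n / 4 - 10 + 10 = n / 4 := by omega
    rw [h2] at h1
    omega
  · have h4 : ((Q.card : ℝ)) ^ 4 ≤ (1 / 4 * (n : ℝ) ^ ((1 : ℝ) / 4)) ^ 4 :=
      pow_le_pow_left₀ (by positivity) hlt.le 4
    have h5 : ((n : ℝ) ^ ((1 : ℝ) / 4)) ^ 4 = n := by
      rw [← Real.rpow_natCast, ← Real.rpow_mul (by positivity)]
      norm_num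
    rw [mul_pow, h5] at h4
    have h6 : 256 * Q.card ^ 4 ≤ n := by
      have : (256 : ℝ) * (Q.card : ℝ) ^ 4 ≤ n := by linarith
      exact_mod_cast this
    rcases Nat.eq_zero_or_pos Q.card with h0 | h0
    · simp [h0]
    · have : Q.card ^ 3 ≤ Q.card ^ 4 := Nat.pow_le_pow_right h0 (by norm_num)
      omega
end

section
/- For every ε > 0 there exist a constant c > 0 and N ∈ ℕ such that for all n ≥ N: every finite set Q of queries over the variables of LOP_n whose slabs cover all admissible points of LOP_n satisfies |Q| ≥ c·n^{(1−ε)/4}. -/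
/-- `x` (with `x i j` standing for the value of the variable `P_{i,j}`, `i ≠ j`)
is an admissible point of `LOP_n`: all values (on off-diagonal pairs) lie in
`{0,1/2,1}` and all constraints of the Least Ordering Principle hold. -/
def LOPAdmissible (n : ℕ) (x : Fin n → Fin n → ℚ) : Prop :=
  (∀ i j, i ≠ j → x i j = 0 ∨ x i j = 1/2 ∨ x i j = 1) ∧
  (∀ i j, i ≠ j → x i j + x j i = 1) ∧
  (∀ i j k, i ≠ j → j ≠ k → i ≠ k → x i j + x j k - 1 ≤ x i k) ∧
  (∀ j, 1 ≤ ∑ i ∈ Finset.univ.filter (fun i => i ≠ j), x i j)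

theorem aux_central (k : ℕ) : (Nat.centralBinom k) ^ 2 * (2 * k + 1) ≤ 16 ^ k := by
  induction k with
  | zero => simp
  | succ k ih =>
    have h := Nat.succ_mul_centralBinom_succ k
    have h2 : ((k + 1) * Nat.centralBinom (k + 1)) ^ 2 * (2 * k + 3) ≤
        (k + 1) ^ 2 * 16 ^ (k + 1) := by
      rw [h]
      calc (2 * (2 * k + 1) * Nat.centralBinom k) ^ 2 * (2 * k + 3)
          = (Nat.centralBinom k ^ 2 * (2 * k + 1)) * (4 * ((2 * k + 1) * (2 * k + 3))) := by ring
        _ ≤ 16 ^ k * (4 * (4 * (k + 1) ^ 2)) := by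
            refine Nat.mul_le_mul ih (Nat.mul_le_mul_left 4 ?_)
            nlinarith
        _ = _ := by ring
    have h3 : (k + 1) ^ 2 * (Nat.centralBinom (k + 1) ^ 2 * (2 * (k + 1) + 1)) ≤
        (k + 1) ^ 2 * 16 ^ (k + 1) := by
      calc _ = ((k + 1) * Nat.centralBinom (k + 1)) ^ 2 * (2 * k + 3) := by ring
        _ ≤ _ := h2
    exact Nat.le_of_mul_le_mul_left h3 (by positivity)

theorem aux_choose (k : ℕ) : (k.choose (k / 2)) ^ 2 * (k + 1) ≤ 4 ^ k := by
  obtain ⟨j, rfl | rfl⟩ := Nat.even_or_odd' k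
  · have := aux_central j
    rw [Nat.centralBinom] at this
    rw [Nat.mul_div_cancel_left j (by norm_num), pow_mul]
    exact this
  · have h := aux_central (j + 1)
    have h1 : Nat.centralBinom (j + 1) = 2 * (2 * j + 1).choose j := by
      rw [Nat.centralBinom, show 2 * (j + 1) = (2 * j + 1) + 1 by ring, Nat.choose_succ_succ,
        Nat.choose_symm_half]
      ring
    have h2 : (2 * j + 1) / 2 = j := by omega
    rw [h2]
    rw [h1] at h
    have h3 : (16 : ℕ) ^ (j + 1) = 4 * 4 ^ (2 * j + 1) := by
      rw [show (16 : ℕ) = 4 ^ 2 by norm_num, ← pow_mul]; ring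
    rw [h3] at h
    nlinarith [sq_nonneg ((2 * j + 1).choose j)]

theorem aux_LO_s12 {T : Type*} [Fintype T] [DecidableEq T] (d : T → ℤ) (F : Finset (Finset T))
    (hF : ∀ A ∈ F, ∀ B ∈ F, ∑ t ∈ A, d t = ∑ t ∈ B, d t) (K : ℕ)
    (hK : K ≤ (Finset.univ.filter (fun t => d t ≠ 0)).card) :
    F.card ^ 2 * (K + 1) ≤ 4 ^ Fintype.card T := by
  set D := Finset.univ.filter (fun t => d t ≠ 0) with hD
  have hmemD : ∀ t, t ∈ D ↔ d t ≠ 0 := by intro t; simp [hD]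
  let φ : Finset T → Finset D := fun A => Finset.univ.filter (fun t => (t : T) ∈ A ↔ 0 < d t)
  have hφ : ∀ A (t : D), t ∈ φ A ↔ ((t : T) ∈ A ↔ 0 < d t) := by intro A t; simp [φ]
  have hsum : ∀ A : Finset T, ∑ t ∈ A, d t = ∑ t, if t ∈ A then d t else 0 := by
    intro A; simp
  have hanti : ∀ A ∈ F, ∀ B ∈ F, φ A ⊆ φ B → φ A = φ B := by
    intro A hA B hB hAB
    have hle : ∀ t ∈ Finset.univ, (if t ∈ A then d t else 0) ≤ (if t ∈ B then d t else 0) := by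
      intro t _
      by_cases h0 : d t = 0
      · simp [h0]
      · have h1 := @hAB ⟨t, (hmemD t).2 h0⟩
        rw [hφ, hφ] at h1
        simp only at h1
        rcases lt_or_gt_of_ne h0 with h | h <;> split_ifs <;> first | omega | (exfalso; grind)
    have heq := hF A hA B hB
    rw [hsum, hsum, Finset.sum_eq_sum_iff_of_le hle] at heq
    ext t
    rw [hφ, hφ]
    have h1 := heq t (Finset.mem_univ _)
    have h2 := (hmemD t).1 t.2
    have : (t : T) ∈ A ↔ (t : T) ∈ B := by
      split_ifs at h1 <;> grind
    rw [this]
  have hfib : ∀ B ∈ F.image (fun A => A \ D),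
      (F.filter (fun A => A \ D = B)).card ≤ D.card.choose (D.card / 2) := by
    intro B _
    have hinj : Set.InjOn φ (F.filter (fun A => A \ D = B) : Finset (Finset T)) := by
      intro A hA A' hA' h
      simp only [Finset.coe_filter, Set.mem_ofPred_eq] at hA hA'
      ext t
      by_cases ht : t ∈ D
      · have h1 : (⟨t, ht⟩ : D) ∈ φ A ↔ (⟨t, ht⟩ : D) ∈ φ A' := by rw [h]
        rw [hφ, hφ] at h1
        simp only at h1
        tauto
      · have h1 : t ∈ A \ D ↔ t ∈ A' \ D := by rw [hA.2, hA'.2]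
        simpa [ht] using h1
    rw [← Finset.card_image_of_injOn hinj]
    have hs : IsAntichain (· ⊆ ·)
        (((F.filter (fun A => A \ D = B)).image φ : Finset (Finset D)) : Set (Finset D)) := by
      intro X hX Y hY hne hsub
      simp only [Finset.coe_image, Finset.coe_filter, Set.mem_image, Set.mem_ofPred_eq] at hX hY
      obtain ⟨A, ⟨hA, _⟩, rfl⟩ := hX
      obtain ⟨A', ⟨hA', _⟩, rfl⟩ := hY
      exact hne (hanti A hA A' hA' hsub)
    have := hs.sperner
    simpa using this
  have h1 := Finset.card_le_mul_card_image F _ hfib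
  have h2 : (F.image (fun A => A \ D)).card ≤ 2 ^ (Fintype.card T - D.card) := by
    rw [← Finset.card_compl, ← Finset.card_powerset]
    apply Finset.card_le_card
    intro X hX
    simp only [Finset.mem_image] at hX
    obtain ⟨A, _, rfl⟩ := hX
    rw [Finset.mem_powerset]
    intro t ht
    simp at ht ⊢
    exact ht.2
  have hDT : D.card ≤ Fintype.card T := Finset.card_le_univ D
  calc F.card ^ 2 * (K + 1)
      ≤ (D.card.choose (D.card / 2) * 2 ^ (Fintype.card T - D.card)) ^ 2 * (D.card + 1) := by
        gcongr
        exact h1.trans (by gcongr)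
    _ = (D.card.choose (D.card / 2) ^ 2 * (D.card + 1)) * 4 ^ (Fintype.card T - D.card) := by
        rw [mul_pow, ← pow_mul, mul_comm _ 2, pow_mul]; norm_num; ring
    _ ≤ 4 ^ D.card * 4 ^ (Fintype.card T - D.card) := by
        gcongr
        exact aux_choose _
    _ = 4 ^ Fintype.card T := by rw [← pow_add]; congr 1; omega

def auxPt {n : ℕ} (r : Fin n → ℕ) (i j : Fin n) : ℚ :=
  if r i < r j then 1 else if r j < r i then 0 else 1 / 2

theorem aux_adm {n : ℕ} (r : Fin n → ℕ) (s : Finset (Fin n)) (hs : 3 ≤ s.card)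
    (h0 : ∀ i ∈ s, r i = 0) : LOPAdmissible n (auxPt r) := by
  have hnn : ∀ i j, 0 ≤ auxPt r i j := by
    intro i j; unfold auxPt; split_ifs <;> norm_num
  refine ⟨?_, ?_, ?_, ?_⟩
  · intro i j _; unfold auxPt; split_ifs <;> simp
  · intro i j _; unfold auxPt; split_ifs <;> first | omega | norm_num
  · intro i j k _ _ _; unfold auxPt; split_ifs <;> first | omega | norm_num
  · intro j
    have hc : 2 ≤ (s.erase j).card := by
      have := Finset.pred_card_le_card_erase (s := s) (a := j); omega
    have h1 : ∀ i ∈ s.erase j, (1 / 2 : ℚ) ≤ auxPt r i j := by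
      intro i hi
      have := h0 i (Finset.mem_of_mem_erase hi)
      unfold auxPt; split_ifs <;> first | omega | norm_num
    have h2 := Finset.card_nsmul_le_sum _ _ _ h1
    have h3 : ∑ i ∈ s.erase j, auxPt r i j ≤
        ∑ i ∈ Finset.univ.filter (fun i => i ≠ j), auxPt r i j := by
      apply Finset.sum_le_sum_of_subset_of_nonneg
      · intro i hi; simp at hi ⊢; exact hi.1
      · intros; apply hnn
    have h4 : (2 : ℚ) ≤ ((s.erase j).card : ℚ) := by exact_mod_cast hc
    rw [nsmul_eq_mul] at h2
    linarith

/-- value of a query at the point given by a rank function -/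
noncomputable def auxVal {n : ℕ} (q : Fin n × Fin n → ℤ) (r : Fin n → ℕ) : ℝ :=
  ∑ p ∈ Finset.univ.filter (fun p : Fin n × Fin n => p.1 ≠ p.2),
    (q p : ℝ) * (auxPt r p.1 p.2 : ℝ)

theorem aux_int {n : ℕ} (q : Fin n × Fin n → ℤ) (r : Fin n → ℕ)
    (h : ∀ i j, i ≠ j → r i = r j → Even (q (i, j) + q (j, i))) :
    ∃ z : ℤ, auxVal q r = z := by
  let y : Fin n × Fin n → ℤ := fun p =>
    if r p.1 < r p.2 then 2 else if r p.2 < r p.1 then 0 else 1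
  have hy : ∀ p, (auxPt r p.1 p.2 : ℝ) = (y p : ℝ) / 2 := by
    intro p; simp only [auxPt, y]; split_ifs <;> norm_num
  have hz : ((∑ p ∈ Finset.univ.filter (fun p : Fin n × Fin n => p.1 ≠ p.2), q p * y p : ℤ)
      : ZMod 2) = 0 := by
    push_cast
    apply Finset.sum_involution (fun p _ => p.swap)
    · intro p hp
      simp only [Finset.mem_filter, Finset.mem_univ, true_and] at hp
      rw [← Int.cast_mul, ← Int.cast_mul, ← Int.cast_add, ZMod.intCast_eq_zero_iff_even]
      simp only [y, Prod.fst_swap, Prod.snd_swap]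
      split_ifs <;> try omega
      · simp
      · simp
      · have h5 := h p.1 p.2 hp (by omega)
        simp only [mul_one]
        exact h5
    · intro p hp _ h2
      simp only [Finset.mem_filter, Finset.mem_univ, true_and] at hp
      exact hp (congrArg Prod.snd h2)
    · intro p hp; simp
    · intro p hp
      simp only [Finset.mem_filter, Finset.mem_univ, true_and, Prod.fst_swap, Prod.snd_swap] at hp ⊢
      exact hp.symm
  rw [ZMod.intCast_eq_zero_iff_even] at hz
  obtain ⟨z, hz⟩ := hz
  refine ⟨z, ?_⟩
  have h3 : ((∑ p ∈ Finset.univ.filter (fun p : Fin n × Fin n => p.1 ≠ p.2), q p * y p : ℤ) : ℝ)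
      = z + z := by rw [hz]; push_cast; rfl
  push_cast at h3
  have h4 : auxVal q r = (∑ p ∈ Finset.univ.filter (fun p : Fin n × Fin n => p.1 ≠ p.2),
      (q p : ℝ) * (y p : ℝ)) / 2 := by
    unfold auxVal
    rw [Finset.sum_div]
    apply Finset.sum_congr rfl
    intro p _
    rw [hy]; ring
  rw [h4, h3]; ring

section
variable {n : ℕ} {T : Type} [Fintype T] [DecidableEq T]

noncomputable def auxRk (e : T ⊕ T → Fin n) (A : Finset T) : Fin n → ℕ :=
  Function.extend e
    (Sum.elim (fun t => 2 * (e (Sum.inl t)).val + 1 + if t ∈ A then 1 else 0)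
      (fun t => 2 * (e (Sum.inl t)).val + 2 - if t ∈ A then 1 else 0)) 0

theorem auxRk_inl (e : T ⊕ T → Fin n) (he : Function.Injective e) (A : Finset T) (t : T) :
    auxRk e A (e (Sum.inl t)) = 2 * (e (Sum.inl t)).val + 1 + if t ∈ A then 1 else 0 := by
  unfold auxRk; rw [he.extend_apply]; rfl

theorem auxRk_inr (e : T ⊕ T → Fin n) (he : Function.Injective e) (A : Finset T) (t : T) :
    auxRk e A (e (Sum.inr t)) = 2 * (e (Sum.inl t)).val + 2 - if t ∈ A then 1 else 0 := by
  unfold auxRk; rw [he.extend_apply]; rfl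

theorem auxRk_out (e : T ⊕ T → Fin n) (A : Finset T) (i : Fin n) (hi : ∀ s, e s ≠ i) :
    auxRk e A i = 0 := by
  unfold auxRk; rw [Function.extend_apply']
  · rfl
  · rintro ⟨s, hs⟩; exact hi s hs

/-- ranks of vertices outside the pair `t` do not fall in the window of `t`, and do not
depend on whether `t` is flipped -/
theorem auxRk_other (e : T ⊕ T → Fin n) (he : Function.Injective e) (A : Finset T) (t : T)
    (i : Fin n) (h1 : i ≠ e (Sum.inl t)) (h2 : i ≠ e (Sum.inr t)) :
    auxRk e (insert t A) i = auxRk e A i ∧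
    (auxRk e A i < 2 * (e (Sum.inl t)).val + 1 ∨ 2 * (e (Sum.inl t)).val + 2 < auxRk e A i) := by
  by_cases hi : ∃ s, e s = i
  · obtain ⟨s, rfl⟩ := hi
    have key : ∀ t', t' ≠ t → (e (Sum.inl t')).val ≠ (e (Sum.inl t)).val := by
      intro t' h h'
      exact h (Sum.inl_injective (he (Fin.ext h')))
    rcases s with t' | t'
    · have hne : t' ≠ t := by rintro rfl; exact h1 rfl
      have := key t' hne
      rw [auxRk_inl e he, auxRk_inl e he]
      simp only [Finset.mem_insert, hne, false_or, true_and]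
      split_ifs <;> omega
    · have hne : t' ≠ t := by rintro rfl; exact h2 rfl
      have := key t' hne
      rw [auxRk_inr e he, auxRk_inr e he]
      simp only [Finset.mem_insert, hne, false_or, true_and]
      split_ifs <;> omega
  · push Not at hi
    rw [auxRk_out e _ i hi, auxRk_out e _ i hi]
    simp

theorem auxRk_tie (e : T ⊕ T → Fin n) (he : Function.Injective e) (A : Finset T)
    (i j : Fin n) (hij : i ≠ j) (h : auxRk e A i = auxRk e A j) : ∀ s, e s ≠ i := by
  rintro s rfl
  have main : ∀ t, (e (Sum.inl t) = e s ∨ e (Sum.inr t) = e s) → False := by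
    intro t ht
    have hl := auxRk_inl e he A t
    have hr := auxRk_inr e he A t
    by_cases h1 : j = e (Sum.inl t)
    · rcases ht with ht | ht
      · exact hij (ht.symm.trans h1.symm)
      · rw [← ht, h1, hl, hr] at h; split_ifs at h <;> omega
    by_cases h2 : j = e (Sum.inr t)
    · rcases ht with ht | ht
      · rw [← ht, h2, hl, hr] at h; split_ifs at h <;> omega
      · exact hij (ht.symm.trans h2.symm)
    have := (auxRk_other e he A t j h1 h2).2
    rcases ht with ht | ht <;> rw [← ht] at h <;> split_ifs at hl hr <;> omega
  rcases s with t | t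
  · exact main t (Or.inl rfl)
  · exact main t (Or.inr rfl)

theorem auxVal_insert (e : T ⊕ T → Fin n) (he : Function.Injective e)
    (q : Fin n × Fin n → ℤ) (A : Finset T) (t : T) (ht : t ∉ A) :
    auxVal q (auxRk e (insert t A)) = auxVal q (auxRk e A) -
      ((q (e (Sum.inl t), e (Sum.inr t)) - q (e (Sum.inr t), e (Sum.inl t)) : ℤ) : ℝ) := by
  set a := e (Sum.inl t) with ha
  set b := e (Sum.inr t) with hb
  have hab : a ≠ b := by intro h; have := he h; simp at this
  have hA1 := auxRk_inl e he A t
  have hA2 := auxRk_inr e he A t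
  have hB1 := auxRk_inl e he (insert t A) t
  have hB2 := auxRk_inr e he (insert t A) t
  simp only [ht, Finset.mem_insert_self, if_true, if_false, ← ha, ← hb] at hA1 hA2 hB1 hB2
  have hsub : ({(a, b), (b, a)} : Finset (Fin n × Fin n)) ⊆
      Finset.univ.filter (fun p : Fin n × Fin n => p.1 ≠ p.2) := by
    intro p hp
    simp only [Finset.mem_insert, Finset.mem_singleton] at hp
    rcases hp with rfl | rfl <;> simp [hab, hab.symm]
  have hne : (a, b) ≠ (b, a) := by simp [hab]
  unfold auxVal
  rw [← Finset.sum_sdiff hsub, ← Finset.sum_sdiff hsub, Finset.sum_pair hne, Finset.sum_pair hne]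
  have hrest : ∑ p ∈ Finset.univ.filter (fun p : Fin n × Fin n => p.1 ≠ p.2) \ {(a, b), (b, a)},
      (q p : ℝ) * (auxPt (auxRk e (insert t A)) p.1 p.2 : ℝ) =
      ∑ p ∈ Finset.univ.filter (fun p : Fin n × Fin n => p.1 ≠ p.2) \ {(a, b), (b, a)},
      (q p : ℝ) * (auxPt (auxRk e A) p.1 p.2 : ℝ) := by
    apply Finset.sum_congr rfl
    rintro ⟨i, j⟩ hp
    simp only [Finset.mem_sdiff, Finset.mem_filter, Finset.mem_univ, true_and, Finset.mem_insert,
      Finset.mem_singleton, Prod.mk.injEq, not_or] at hp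
    have oth : ∀ i, (i = a ∨ i = b) ∨ (auxRk e (insert t A) i = auxRk e A i ∧
        (auxRk e A i < 2 * a.val + 1 ∨ 2 * a.val + 2 < auxRk e A i)) := by
      intro i
      by_cases h1 : i = a
      · exact Or.inl (Or.inl h1)
      by_cases h2 : i = b
      · exact Or.inl (Or.inr h2)
      exact Or.inr (auxRk_other e he A t i h1 h2)
    congr 2
    simp only [auxPt]
    obtain ⟨hij, hp1, hp2⟩ := hp
    rcases oth i with (rfl | rfl) | ⟨hi1, hi2⟩ <;> rcases oth j with (rfl | rfl) | ⟨hj1, hj2⟩ <;>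
      first
      | (exfalso; tauto)
      | (split_ifs <;> first | rfl | omega)
  rw [hrest]
  simp only [auxPt, hA1, hA2, hB1, hB2]
  push_cast
  norm_num
  ring

theorem auxVal_eq (e : T ⊕ T → Fin n) (he : Function.Injective e)
    (q : Fin n × Fin n → ℤ) (A : Finset T) :
    auxVal q (auxRk e A) = auxVal q (auxRk e ∅) -
      ((∑ t ∈ A, (q (e (Sum.inl t), e (Sum.inr t)) - q (e (Sum.inr t), e (Sum.inl t))) : ℤ) : ℝ) := by
  induction A using Finset.induction_on with
  | empty => simp
  | insert t A ht ih =>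
    rw [auxVal_insert e he q A t ht, ih, Finset.sum_insert ht]
    push_cast
    ring

end

/-- A labelled matching: edges are disjoint, odd for their label, and each label is used at
most `K` times. -/
def AuxMatch {n : ℕ} {ι : Type} [Fintype ι] [DecidableEq ι] (f : ι → (Fin n × Fin n → ℤ) × ℤ) (K : ℕ)
    (M : Finset (Fin n × Fin n × ι)) : Prop :=
  (∀ x ∈ M, x.1 ≠ x.2.1 ∧ Odd ((f x.2.2).1 (x.1, x.2.1) + (f x.2.2).1 (x.2.1, x.1))) ∧
  (∀ x ∈ M, ∀ y ∈ M, x ≠ y →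
    x.1 ≠ y.1 ∧ x.1 ≠ y.2.1 ∧ x.2.1 ≠ y.1 ∧ x.2.1 ≠ y.2.1) ∧
  (∀ q, (M.filter (fun x => x.2.2 = q)).card ≤ K)

theorem aux_main_s12 {n : ℕ} {ι : Type} [Fintype ι] [DecidableEq ι] (f : ι → (Fin n × Fin n → ℤ) × ℤ)
    (hcov : ∀ x : Fin n → Fin n → ℚ, LOPAdmissible n x →
      ∃ a,
        ((f a).2 : ℝ) - 1 <
            ∑ p ∈ Finset.univ.filter (fun p : Fin n × Fin n => p.1 ≠ p.2),
              ((f a).1 p : ℝ) * (x p.1 p.2 : ℝ) ∧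
          ∑ p ∈ Finset.univ.filter (fun p : Fin n × Fin n => p.1 ≠ p.2),
              ((f a).1 p : ℝ) * (x p.1 p.2 : ℝ) < ((f a).2 : ℝ)) :
    n ≤ 2 * Fintype.card ι ^ 3 + 2 := by
  by_contra hn
  push Not at hn
  set K := Fintype.card ι ^ 2 with hK
  obtain ⟨M, hM⟩ : ∃ M, Maximal (AuxMatch f K) M := by
    have hfin : {M | AuxMatch f K M}.Finite := Set.toFinite _
    exact hfin.exists_maximal ⟨∅, by simp [AuxMatch]⟩
  obtain ⟨⟨hM1, hM2, hM3⟩, hmax⟩ := hM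
  have hMcard : M.card ≤ K * Fintype.card ι := by
    have h := Finset.card_le_mul_card_image_of_maps_to (s := M) (t := (Finset.univ : Finset ι))
      (f := fun x => x.2.2) (fun _ _ => Finset.mem_univ _) K (fun q _ => hM3 q)
    simpa using h
  let e : M ⊕ M → Fin n := Sum.elim (fun x => x.1.1) (fun x => x.1.2.1)
  have he : Function.Injective e := by
    have key : ∀ x y : M, x ≠ y → x.1.1 ≠ y.1.1 ∧ x.1.1 ≠ y.1.2.1 ∧ x.1.2.1 ≠ y.1.1 ∧
        x.1.2.1 ≠ y.1.2.1 := fun x y h => hM2 x x.2 y y.2 (fun h' => h (Subtype.ext h'))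
    rintro (x | x) (y | y) h <;> simp only [e, Sum.elim_inl, Sum.elim_inr] at h <;>
      by_cases hxy : x = y
    · rw [hxy]
    · exact absurd h (key x y hxy).1
    · subst hxy; exact absurd h (hM1 x x.2).1
    · exact absurd h (key x y hxy).2.1
    · subst hxy; exact absurd h.symm (hM1 x x.2).1
    · exact absurd h (key x y hxy).2.2.1
    · rw [hxy]
    · exact absurd h (key x y hxy).2.2.2
  let W : Finset (Fin n) := (Finset.univ.image e)ᶜ
  have hW : ∀ i, i ∈ W ↔ ∀ s, e s ≠ i := by intro i; simp [W]
  have hWcard : 3 ≤ W.card := by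
    have h1 : (Finset.univ.image e).card = 2 * M.card := by
      rw [Finset.card_image_of_injective _ he]
      simp
      ring
    have h2 : W.card = n - 2 * M.card := by
      simp only [W]
      rw [Finset.card_compl, h1, Fintype.card_fin]
    have h3 : K * Fintype.card ι = Fintype.card ι ^ 3 := by rw [hK]; ring
    omega
  have hadm : ∀ A : Finset M, LOPAdmissible n (auxPt (auxRk e A)) := fun A =>
    aux_adm _ W hWcard (fun i hi => auxRk_out e A i ((hW i).1 hi))
  let F : ι → Finset (Finset M) := fun q => Finset.univ.filter (fun A =>
    ((f q).2 : ℝ) - 1 < auxVal (f q).1 (auxRk e A) ∧ auxVal (f q).1 (auxRk e A) < (f q).2)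
  have hcover : (Finset.univ : Finset (Finset M)) ⊆ Finset.univ.biUnion F := by
    intro A _
    obtain ⟨a, h⟩ := hcov _ (hadm A)
    rw [Finset.mem_biUnion]
    refine ⟨a, Finset.mem_univ _, ?_⟩
    simp only [F, Finset.mem_filter, Finset.mem_univ, true_and]
    exact h
  have hFb : ∀ q, (F q).card ^ 2 * (K + 1) ≤ 4 ^ M.card := by
    intro q
    rcases lt_or_ge (M.filter (fun x => x.2.2 = q)).card K with hlt | hge
    · -- the label is not saturated: nothing is covered
      have hempty : F q = ∅ := by
        rw [Finset.eq_empty_iff_forall_notMem]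
        intro A hA
        simp only [F, Finset.mem_filter, Finset.mem_univ, true_and] at hA
        obtain ⟨z, hz⟩ := aux_int (f q).1 (auxRk e A) (by
          intro i j hij hr
          by_contra hodd
          rw [Int.not_even_iff_odd] at hodd
          have hi := auxRk_tie e he A i j hij hr
          have hj := auxRk_tie e he A j i hij.symm hr.symm
          have hil : ∀ x ∈ M, x.1 ≠ i := fun x hx => hi (Sum.inl ⟨x, hx⟩)
          have hir : ∀ x ∈ M, x.2.1 ≠ i := fun x hx => hi (Sum.inr ⟨x, hx⟩)
          have hjl : ∀ x ∈ M, x.1 ≠ j := fun x hx => hj (Sum.inl ⟨x, hx⟩)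
          have hjr : ∀ x ∈ M, x.2.1 ≠ j := fun x hx => hj (Sum.inr ⟨x, hx⟩)
          have hnew : AuxMatch f K (insert (i, j, q) M) := by
            refine ⟨?_, ?_, ?_⟩
            · intro x hx
              rcases Finset.mem_insert.1 hx with rfl | hx
              · exact ⟨hij, hodd⟩
              · exact hM1 x hx
            · intro x hx y hy hxy
              rcases Finset.mem_insert.1 hx with rfl | hx <;>
                rcases Finset.mem_insert.1 hy with rfl | hy
              · exact absurd rfl hxy
              · exact ⟨(hil y hy).symm, (hir y hy).symm, (hjl y hy).symm, (hjr y hy).symm⟩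
              · exact ⟨hil x hx, hjl x hx, hir x hx, hjr x hx⟩
              · exact hM2 x hx y hy hxy
            · intro q'
              rw [Finset.filter_insert]
              split_ifs with hq
              · simp only at hq
                subst hq
                exact (Finset.card_insert_le _ _).trans hlt
              · exact hM3 q'
          have hmem := hmax hnew (Finset.subset_insert _ _) (Finset.mem_insert_self _ _)
          exact hil _ hmem rfl)
        rw [hz] at hA
        have h1 : (f q).2 - 1 < z := by exact_mod_cast hA.1
        have h2 : z < (f q).2 := by exact_mod_cast hA.2
        omega
      rw [hempty]; simp
    · -- the label is saturated: Littlewood-Offord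
      have h := aux_LO_s12 (T := M) (fun t => (f q).1 (e (Sum.inl t), e (Sum.inr t)) -
        (f q).1 (e (Sum.inr t), e (Sum.inl t))) (F q) (by
          intro A hA B hB
          simp only [F, Finset.mem_filter, Finset.mem_univ, true_and] at hA hB
          rw [auxVal_eq e he] at hA hB
          set x := ∑ t ∈ A, ((f q).1 (e (Sum.inl t), e (Sum.inr t)) -
            (f q).1 (e (Sum.inr t), e (Sum.inl t)))
          set y := ∑ t ∈ B, ((f q).1 (e (Sum.inl t), e (Sum.inr t)) -
            (f q).1 (e (Sum.inr t), e (Sum.inl t)))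
          have h1 : (x : ℝ) < y + 1 := by linarith [hA.1, hB.2]
          have h2 : (y : ℝ) < x + 1 := by linarith [hA.2, hB.1]
          have h3 : x < y + 1 := by exact_mod_cast h1
          have h4 : y < x + 1 := by exact_mod_cast h2
          omega) K (by
          refine hge.trans ?_
          refine (Finset.card_le_card (t := (Finset.univ.filter (fun t : M =>
            (f q).1 (e (Sum.inl t), e (Sum.inr t)) -
              (f q).1 (e (Sum.inr t), e (Sum.inl t)) ≠ 0)).image Subtype.val) ?_).trans
            Finset.card_image_le
          intro x hx
          rw [Finset.mem_filter] at hx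
          obtain ⟨hxM, rfl⟩ := hx
          rw [Finset.mem_image]
          refine ⟨⟨x, hxM⟩, ?_, rfl⟩
          simp only [Finset.mem_filter, Finset.mem_univ, true_and]
          have h1 := (hM1 x hxM).2
          intro h2
          simp only [e, Sum.elim_inl, Sum.elim_inr] at h2
          rw [Int.odd_iff] at h1
          omega)
      simpa using h
  have hsum : 2 ^ M.card ≤ ∑ q : ι, (F q).card := by
    have h := (Finset.card_le_card hcover).trans Finset.card_biUnion_le
    simpa using h
  have hS : ∀ q, (F q).card * Fintype.card ι < 2 ^ M.card := by
    intro q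
    have h := hFb q
    rcases Nat.eq_zero_or_pos (F q).card with h0 | h0
    · rw [h0]; simp
    · apply lt_of_pow_lt_pow_left₀ 2 (by positivity)
      have h4 : ((2 : ℕ) ^ M.card) ^ 2 = 4 ^ M.card := by
        rw [← pow_mul, mul_comm, pow_mul]; norm_num
      rw [h4]
      rw [hK] at h
      nlinarith [pow_pos h0 2]
  have hne : (Finset.univ : Finset ι).Nonempty := by
    by_contra h
    rw [Finset.not_nonempty_iff_eq_empty] at h
    rw [h] at hsum
    simp at hsum
  have h1 := Finset.sum_lt_sum_of_nonempty hne (fun q _ => hS q)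
  rw [← Finset.sum_mul] at h1
  simp only [Finset.sum_const, Finset.card_univ, smul_eq_mul] at h1
  nlinarith [Nat.mul_le_mul_right (Fintype.card ι) hsum]

/-- for every `ε > 0` there are `c > 0` and `N` such that for all
`n ≥ N`: every finite set `Q` of queries over the variables `P_{i,j}` of `LOP_n`
whose slabs cover all admissible points of `LOP_n` satisfies
`|Q| ≥ c · n^{(1-ε)/4}`. -/
theorem statement_12 (ε : ℝ) (hε : 0 < ε) : ∃ c : ℝ, 0 < c ∧ ∃ N : ℕ, ∀ n ≥ N,
    ∀ Q : Finset ((Fin n × Fin n → ℤ) × ℤ),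
    (∀ x : Fin n → Fin n → ℚ, LOPAdmissible n x →
      ∃ a ∈ Q,
        (a.2 : ℝ) - 1 <
            ∑ p ∈ Finset.univ.filter (fun p : Fin n × Fin n => p.1 ≠ p.2),
              (a.1 p : ℝ) * (x p.1 p.2 : ℝ) ∧
          ∑ p ∈ Finset.univ.filter (fun p : Fin n × Fin n => p.1 ≠ p.2),
              (a.1 p : ℝ) * (x p.1 p.2 : ℝ) < (a.2 : ℝ)) →
    c * (n : ℝ) ^ ((1 - ε) / 4) ≤ (Q.card : ℝ) := by
  
  refine ⟨1 / 2, by norm_num, 3, ?_⟩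
  intro n hn Q hcov
  have h := aux_main_s12 (fun a : Q => a.1) (by
    intro x hx
    obtain ⟨a, ha, h⟩ := hcov x hx
    exact ⟨⟨a, ha⟩, h⟩)
  rw [Fintype.card_coe] at h
  have hm : 1 ≤ Q.card := by
    by_contra h0
    have h0 : Q.card = 0 := by omega
    rw [h0] at h
    omega
  have h4 : n ≤ (2 * Q.card) ^ 4 := by
    have h1 : 1 ≤ Q.card ^ 3 := Nat.one_le_pow _ _ hm
    have h2 : Q.card ^ 3 ≤ Q.card ^ 4 := Nat.pow_le_pow_right hm (by norm_num)
    have h3 : (2 * Q.card) ^ 4 = 16 * Q.card ^ 4 := by ring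
    omega
  have h5 : (n : ℝ) ≤ (2 * (Q.card : ℝ)) ^ 4 := by exact_mod_cast h4
  have hn1 : (1 : ℝ) ≤ n := by
    have : 1 ≤ n := by omega
    exact_mod_cast this
  have h6 : (n : ℝ) ^ ((1 - ε) / 4) ≤ 2 * (Q.card : ℝ) := by
    calc (n : ℝ) ^ ((1 - ε) / 4) ≤ (n : ℝ) ^ ((1 : ℝ) / 4) :=
          Real.rpow_le_rpow_of_exponent_le hn1 (by linarith)
      _ ≤ ((2 * (Q.card : ℝ)) ^ 4) ^ ((1 : ℝ) / 4) :=
          Real.rpow_le_rpow (by positivity) h5 (by norm_num)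
      _ = 2 * (Q.card : ℝ) := by
          rw [← Real.rpow_natCast, ← Real.rpow_mul (by positivity)]
          norm_num
  linarith
end
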